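/- Let H be a non-abelian finite simple group. Suppose there is a set of t ≥ 1 pairs (T_{1,s}, T_{2,s}), s = 1, ..., t, of generating triples for H such that: (1) for each prime p dividing |H| there is some s such that T_{1,s} and T_{2,s} are a p-distinguishing pair; and (2) the 6t triples consisting of all 2t triples T_{i,s} (i = 1, 2; s = 1, ..., t) and all their cyclic permutations are mutually inequivalent. Then H^k is a Beauville group for every k with 6t ≤ k ≤ d₂(H). -/

import Mathlib

/-- The set of elements of `G` conjugate to a power of `a`, `b` or `c`. -/
def SigmaSet {G : Type*} [Group G] (a b c : G) : Set G :=
  {g | ∃ d ∈ ({a, b, c} : Set G), ∃ m : ℤ, IsConj (d ^ m) g}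

/-- `G` is an (unmixed) Beauville group. -/
def IsBeauvilleGroup (G : Type*) [Group G] : Prop :=
  ∃ a₁ b₁ c₁ a₂ b₂ c₂ : G,
    (Subgroup.closure {a₁, b₁, c₁} = ⊤ ∧ a₁ * b₁ * c₁ = 1 ∧
      (1 : ℚ) / (orderOf a₁) + 1 / (orderOf b₁) + 1 / (orderOf c₁) < 1) ∧
    (Subgroup.closure {a₂, b₂, c₂} = ⊤ ∧ a₂ * b₂ * c₂ = 1 ∧
      (1 : ℚ) / (orderOf a₂) + 1 / (orderOf b₂) + 1 / (orderOf c₂) < 1) ∧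
    SigmaSet a₁ b₁ c₁ ∩ SigmaSet a₂ b₂ c₂ = {1}

/-- `d₂ H`: the number of orbits of `Aut H` on ordered generating pairs of `H`. -/
noncomputable def d2 (H : Type*) [Group H] : ℕ :=
  Nat.card (Quot (fun p q : {p : H × H // Subgroup.closure {p.1, p.2} = ⊤} =>
    ∃ φ : MulAut H, φ p.val.1 = q.val.1 ∧ φ p.val.2 = q.val.2))

/-- `(x, y, z)` is a generating triple for `H`: `x * y * z = 1` and `{x, y, z}` generates. -/
def IsGenTriple {H : Type*} [Group H] (T : H × H × H) : Prop :=
  T.1 * T.2.1 * T.2.2 = 1 ∧ Subgroup.closure ({T.1, T.2.1, T.2.2} : Set H) = ⊤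

/-- Two triples are equivalent if an automorphism of `H` takes one to the other. -/
def EquivTriple {H : Type*} [Group H] (T T' : H × H × H) : Prop :=
  ∃ φ : MulAut H, φ T.1 = T'.1 ∧ φ T.2.1 = T'.2.1 ∧ φ T.2.2 = T'.2.2

/-- Cyclic permutation of a triple. -/
def cycPerm {H : Type*} (T : H × H × H) : H × H × H := (T.2.1, T.2.2, T.1)

/-- `h` is `p`-full: the highest power of `p` dividing the exponent of `H`
divides the order of `h`. -/
def pFull {H : Type*} [Group H] (p : ℕ) (h : H) : Prop :=
  p ^ ((Monoid.exponent H).factorization p) ∣ orderOf h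

open Classical in
/-- `ν_p(T)`: the number of `p`-full entries of the triple `T`. -/
noncomputable def nuP {H : Type*} [Group H] (p : ℕ) (T : H × H × H) : ℕ :=
  (if pFull p T.1 then 1 else 0) + (if pFull p T.2.1 then 1 else 0) +
    (if pFull p T.2.2 then 1 else 0)

/-- `T₁, T₂` are `p`-distinguishing if `ν_p(T₁) ≠ ν_p(T₂)`. -/
def PDistinguishing {H : Type*} [Group H] (p : ℕ) (T₁ T₂ : H × H × H) : Prop :=
  nuP p T₁ ≠ nuP p T₂

/-- `T₁, T₂` are strongly `p`-distinguishing. -/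
def StronglyPDistinguishing {H : Type*} [Group H] (p : ℕ) (T₁ T₂ : H × H × H) : Prop :=
  PDistinguishing p T₁ T₂ ∧
  ∀ T ∈ ({T₁, T₂} : Set (H × H × H)), nuP p T = 0 →
    (¬ p ^ 2 ∣ Monoid.exponent H ∨
      (¬ p ∣ orderOf T.1 ∧ ¬ p ∣ orderOf T.2.1 ∧ ¬ p ∣ orderOf T.2.2))

section Triples

variable {H : Type*} [Group H]

theorem IsGenTriple.rotate {T : H × H × H} (h : IsGenTriple T) : IsGenTriple (cycPerm T) := by
  obtain ⟨h₁, h₂⟩ := h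
  refine ⟨?_, ?_⟩
  · have : T.2.1 * T.2.2 = T.1⁻¹ := eq_inv_of_mul_eq_one_right (by rw [← mul_assoc, h₁])
    simp [cycPerm, this]
  · rw [← h₂]
    congr 1
    ext x
    simp only [cycPerm, Set.mem_insert_iff, Set.mem_singleton_iff]
    tauto

theorem IsGenTriple.iterate_rotate {T : H × H × H} (h : IsGenTriple T) (n : ℕ) :
    IsGenTriple (cycPerm^[n] T) := by
  induction n with
  | zero => exact h
  | succ n ih => rw [Function.iterate_succ_apply']; exact ih.rotate

theorem IsGenTriple.eq_inv {T : H × H × H} (h : IsGenTriple T) : T.2.2 = (T.1 * T.2.1)⁻¹ :=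
  eq_inv_of_mul_eq_one_right h.1

theorem IsGenTriple.closure_pair {T : H × H × H} (h : IsGenTriple T) :
    Subgroup.closure ({T.1, T.2.1} : Set H) = ⊤ := by
  rw [eq_top_iff, ← h.2, Subgroup.closure_le]
  have h₁ : T.1 ∈ Subgroup.closure ({T.1, T.2.1} : Set H) := Subgroup.subset_closure (by simp)
  have h₂ : T.2.1 ∈ Subgroup.closure ({T.1, T.2.1} : Set H) := Subgroup.subset_closure (by simp)
  rintro x (rfl | rfl | rfl)
  · exact h₁
  · exact h₂
  · rw [h.eq_inv]
    exact inv_mem (mul_mem h₁ h₂)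

theorem isGenTriple_of_closure_pair {x y : H} (h : Subgroup.closure ({x, y} : Set H) = ⊤) :
    IsGenTriple (x, y, (x * y)⁻¹) := by
  refine ⟨by simp, ?_⟩
  rw [eq_top_iff, ← h]
  apply Subgroup.closure_mono
  rintro z (rfl | rfl) <;> simp

theorem EquivTriple.of_pair {T T' : H × H × H} (h : IsGenTriple T) (h' : IsGenTriple T')
    {φ : MulAut H} (h₁ : φ T.1 = T'.1) (h₂ : φ T.2.1 = T'.2.1) : EquivTriple T T' :=
  ⟨φ, h₁, h₂, by rw [h.eq_inv, h'.eq_inv, map_inv, map_mul, h₁, h₂]⟩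

/-- Two generating pairs are related if they lie in the same orbit of `Aut H`. -/
def PairRel (p q : {p : H × H // Subgroup.closure {p.1, p.2} = ⊤}) : Prop :=
  ∃ φ : MulAut H, φ p.val.1 = q.val.1 ∧ φ p.val.2 = q.val.2

theorem pairRel_equivalence : Equivalence (PairRel (H := H)) where
  refl _ := ⟨1, rfl, rfl⟩
  symm := by
    rintro p q ⟨φ, h₁, h₂⟩
    exact ⟨φ⁻¹, by rw [← h₁]; exact φ.symm_apply_apply _,
      by rw [← h₂]; exact φ.symm_apply_apply _⟩
  trans := by
    rintro p q r ⟨φ, h₁, h₂⟩ ⟨ψ, h₃, h₄⟩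
    exact ⟨ψ * φ, by simp [h₁, h₃], by simp [h₂, h₄]⟩

/-- The orbit of the generating pair formed by the first two entries of a generating triple. -/
def tripleClass (T : {T : H × H × H // IsGenTriple T}) : Quot (PairRel (H := H)) :=
  Quot.mk _ ⟨(T.1.1, T.1.2.1), IsGenTriple.closure_pair T.2⟩

theorem tripleClass_eq_iff {T T' : {T : H × H × H // IsGenTriple T}} :
    tripleClass T = tripleClass T' ↔ EquivTriple T.1 T'.1 := by
  constructor
  · intro h
    obtain ⟨φ, h₁, h₂⟩ := pairRel_equivalence.eqvGen_iff.1 (Quot.eqvGen_exact h)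
    exact EquivTriple.of_pair T.2 T'.2 h₁ h₂
  · rintro ⟨φ, h₁, h₂, -⟩
    exact Quot.sound ⟨φ, h₁, h₂⟩

theorem tripleClass_surjective : Function.Surjective (tripleClass (H := H)) := by
  rintro ⟨p, hp⟩
  exact ⟨⟨_, isGenTriple_of_closure_pair hp⟩, rfl⟩

/-- A family of pairwise inequivalent generating triples extends to any index set of size at most
`d2 H`. -/
theorem exists_extension_of_card_le_d2 [Finite H] {α β : Type*} [Fintype β]
    (S : α → H × H × H) (hS : ∀ a, IsGenTriple (S a))
    (hineq : ∀ a b, a ≠ b → ¬ EquivTriple (S a) (S b)) (e : α ↪ β)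
    (hβ : Fintype.card β ≤ d2 H) :
    ∃ U : β → H × H × H, (∀ j, IsGenTriple (U j)) ∧
      (∀ i j, i ≠ j → ¬ EquivTriple (U i) (U j)) ∧ ∀ a, U (e a) = S a := by
  classical
  have : Finite (Quot (PairRel (H := H))) := Quot.finite _
  have := Fintype.ofFinite (Quot (PairRel (H := H)))
  have hcard : Fintype.card β ≤ Fintype.card (Quot (PairRel (H := H))) := by
    rw [← Nat.card_eq_fintype_card (α := Quot _)]
    exact hβ
  have : Finite α := Finite.of_injective e e.injective
  have := Fintype.ofFinite α
  let q : α → Quot (PairRel (H := H)) := fun a => tripleClass ⟨S a, hS a⟩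
  have hq : Function.Injective q := by
    intro a b hab
    by_contra hne
    exact hineq a b hne (tripleClass_eq_iff.1 hab)
  obtain ⟨t, hqt, ht⟩ : ∃ t : Finset (Quot (PairRel (H := H))),
      Finset.univ.image q ⊆ t ∧ t.card = Fintype.card β := by
    obtain ⟨t, h₁, -, h₂⟩ := Finset.exists_subsuperset_card_eq
      (Finset.subset_univ (Finset.univ.image q)) (n := Fintype.card β)
      (by rw [Finset.card_image_of_injective _ hq]
          exact Fintype.card_le_of_injective e e.injective) hcard
    exact ⟨t, h₁, h₂⟩
  obtain ⟨f, hf, hfe⟩ : ∃ f : β → Quot (PairRel (H := H)), f.Injective ∧ ∀ a, f (e a) = q a := by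
    cases isEmpty_or_nonempty α with
    | inl hα =>
      let g := Fintype.equivOfCardEq (α := β) (β := t) (by simp [ht])
      exact ⟨fun j => g j, Subtype.val_injective.comp g.injective, fun a => hα.elim a⟩
    | inr hα =>
      have hinv := Function.leftInverse_invFun e.injective
      obtain ⟨g, hg⟩ := Set.MapsTo.exists_equiv_extend_of_card_eq (t := t) ht.symm
        (s := Set.range e) (f := q ∘ Function.invFun e)
        (by rintro _ ⟨a, rfl⟩
            exact hqt (Finset.mem_image_of_mem _ (Finset.mem_univ _)))
        (by rintro _ ⟨a, rfl⟩ _ ⟨b, rfl⟩ h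
            simp only [Function.comp_apply, hinv a, hinv b] at h
            rw [hq h])
      refine ⟨fun j => g j, Subtype.val_injective.comp g.injective, fun a => ?_⟩
      simp only [hg _ ⟨a, rfl⟩, Function.comp_apply, hinv a]
  have key : ∀ j, ∃ T : {T : H × H × H // IsGenTriple T},
      tripleClass T = f j ∧ ∀ a, e a = j → T.1 = S a := by
    intro j
    by_cases hj : ∃ a, e a = j
    · obtain ⟨a, rfl⟩ := hj
      exact ⟨⟨S a, hS a⟩, (hfe a).symm, fun b hb => by rw [e.injective hb]⟩
    · obtain ⟨T, hT⟩ := tripleClass_surjective (f j)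
      exact ⟨T, hT, fun a ha => (hj ⟨a, ha⟩).elim⟩
  choose U hU hUe using key
  refine ⟨fun j => (U j).1, fun j => (U j).2, fun i j hij h => hij (hf ?_), fun a => hUe _ a rfl⟩
  rw [← hU, ← hU]
  exact tripleClass_eq_iff.2 h

open Classical in
theorem sum_pFull_iterate_cycPerm (p : ℕ) (T : H × H × H) (c : Fin 3) :
    (∑ m : Fin 3, if pFull p (cycPerm^[(c : ℕ)] (cycPerm^[(m : ℕ)] T)).1 then 1 else 0) =
      nuP p T := by
  suffices h : ∀ f : H → ℕ, ∑ m : Fin 3, f (cycPerm^[(c : ℕ)] (cycPerm^[(m : ℕ)] T)).1 =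
      f T.1 + f T.2.1 + f T.2.2 from h fun x => if pFull p x then 1 else 0
  intro f
  rw [Fin.sum_univ_three]
  fin_cases c
  · rfl
  · change f T.2.1 + f T.2.2 + f T.1 = _
    ring
  · change f T.2.2 + f T.1 + f T.2.1 = _
    ring

end Triples

section Products

variable {H ι : Type*} [Group H]

/-- The values at `i` of the elements of `K` that are trivial on `S`. -/
def valuesTrivialOn (K : Subgroup (ι → H)) (i : ι) (S : Set ι) : Subgroup H where
  carrier := {h | ∃ x ∈ K, x i = h ∧ ∀ j ∈ S, x j = 1}
  one_mem' := ⟨1, K.one_mem, rfl, fun _ _ => rfl⟩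
  mul_mem' := by
    rintro _ _ ⟨x, hx, rfl, hxS⟩ ⟨y, hy, rfl, hyS⟩
    exact ⟨x * y, K.mul_mem hx hy, rfl, fun j hj => by simp [hxS j hj, hyS j hj]⟩
  inv_mem' := by
    rintro _ ⟨x, hx, rfl, hxS⟩
    exact ⟨x⁻¹, K.inv_mem hx, rfl, fun j hj => by simp [hxS j hj]⟩

theorem valuesTrivialOn_normal {K : Subgroup (ι → H)} {i : ι}
    (hK : ∀ h, ∃ x ∈ K, x i = h) (S : Set ι) : (valuesTrivialOn K i S).Normal := by
  refine ⟨?_⟩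
  rintro _ ⟨x, hx, rfl, hxS⟩ h
  obtain ⟨y, hy, rfl⟩ := hK h
  exact ⟨y * x * y⁻¹, K.mul_mem (K.mul_mem hy hx) (K.inv_mem hy), rfl,
    fun j hj => by simp [hxS j hj]⟩

/-- A subgroup of a power of a non-abelian simple group is everything if for any two distinct
coordinates the first takes all values on the elements trivial in the second. -/
theorem eq_top_of_valuesTrivialOn_singleton [Finite ι] (hsimple : IsSimpleGroup H)
    (hnonab : ∃ a b : H, a * b ≠ b * a) {K : Subgroup (ι → H)}
    (hK : ∀ i h, ∃ x ∈ K, x i = h)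
    (hpair : ∀ i j, i ≠ j → valuesTrivialOn K i {j} = ⊤) : K = ⊤ := by
  classical
  have := Fintype.ofFinite ι
  have key : ∀ (i : ι) (S : Finset ι), i ∉ S → valuesTrivialOn K i (S : Set ι) = ⊤ := by
    intro i S
    induction S using Finset.induction_on with
    | empty =>
      intro _
      rw [eq_top_iff]
      intro h _
      obtain ⟨x, hx, hxi⟩ := hK i h
      exact ⟨x, hx, hxi, by simp⟩
    | insert j S hj ih =>
      intro hi
      rw [Finset.mem_insert, not_or] at hi
      have hS := ih hi.2
      have hJ := hpair i j hi.1
      refine ((valuesTrivialOn_normal (hK i) _).eq_bot_or_eq_top).resolve_left fun hbot => ?_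
      obtain ⟨a, b, hab⟩ := hnonab
      obtain ⟨x, hx, rfl, hxS⟩ : a ∈ valuesTrivialOn K i (S : Set ι) := hS ▸ Subgroup.mem_top a
      obtain ⟨y, hy, rfl, hyj⟩ : b ∈ valuesTrivialOn K i {j} := hJ ▸ Subgroup.mem_top b
      have hmem : x i * y i * (x i)⁻¹ * (y i)⁻¹ ∈
          valuesTrivialOn K i ((insert j S : Finset ι) : Set ι) := by
        refine ⟨x * y * x⁻¹ * y⁻¹,
          K.mul_mem (K.mul_mem (K.mul_mem hx hy) (K.inv_mem hx)) (K.inv_mem hy), rfl, ?_⟩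
        intro l hl
        rw [Finset.coe_insert, Set.mem_insert_iff] at hl
        rcases hl with rfl | hl
        · simp [hyj l rfl]
        · simp [hxS l hl]
      rw [hbot, Subgroup.mem_bot] at hmem
      apply hab
      rwa [mul_inv_eq_one, mul_inv_eq_iff_eq_mul] at hmem
  rw [eq_top_iff]
  intro x _
  apply Subgroup.pi_mem_of_mulSingle_mem
  intro i
  obtain ⟨y, hy, hyi, hyS⟩ : x i ∈ valuesTrivialOn K i ((Finset.univ.erase i : Finset ι) : Set ι) :=
    key i _ (Finset.notMem_erase _ _) ▸ Subgroup.mem_top _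
  convert hy
  ext j
  by_cases h : j = i
  · subst h; simp [hyi]
  · rw [Pi.mulSingle_eq_of_ne h, hyS j (by simp [h])]

/-- Pairwise inequivalent generating triples of a non-abelian finite simple group generate the
corresponding power of the group. -/
theorem closure_eq_top_of_inequivalent [Finite H] [Finite ι] (hsimple : IsSimpleGroup H)
    (hnonab : ∃ a b : H, a * b ≠ b * a) {U : ι → H × H × H}
    (hU : ∀ j, IsGenTriple (U j)) (hineq : ∀ i j, i ≠ j → ¬ EquivTriple (U i) (U j)) :
    Subgroup.closure {fun j => (U j).1, fun j => (U j).2.1, fun j => (U j).2.2} = ⊤ := by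
  set K : Subgroup (ι → H) :=
    Subgroup.closure {fun j => (U j).1, fun j => (U j).2.1, fun j => (U j).2.2} with hKdef
  have hsurj : ∀ i h, ∃ x ∈ K, x i = h := by
    intro i h
    have : K.map (Pi.evalMonoidHom (fun _ => H) i) = ⊤ := by
      rw [hKdef, MonoidHom.map_closure, ← (hU i).2]
      congr 1
      simp [Set.image_insert_eq]
    obtain ⟨x, hx, hxh⟩ : h ∈ K.map (Pi.evalMonoidHom (fun _ => H) i) := this ▸ Subgroup.mem_top h
    exact ⟨x, hx, hxh⟩
  refine eq_top_of_valuesTrivialOn_singleton hsimple hnonab hsurj fun i j hij => ?_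
  refine ((valuesTrivialOn_normal (hsurj i) _).eq_bot_or_eq_top).resolve_left fun hbot => ?_
  apply hineq j i hij.symm
  let π : ι → K →* H := fun l => (Pi.evalMonoidHom (fun _ => H) l).comp K.subtype
  have hπ : ∀ l, Function.Surjective (π l) := by
    intro l h
    obtain ⟨x, hx, hxh⟩ := hsurj l h
    exact ⟨⟨x, hx⟩, hxh⟩
  have hker : (π j).ker ≤ (π i).ker := by
    intro x hx
    have : (x : ι → H) i ∈ valuesTrivialOn K i {j} :=
      ⟨x, x.2, rfl, by rintro _ rfl; exact hx⟩
    rw [hbot] at this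
    exact this
  let φ : H →* H := (π j).liftOfSurjective (hπ j) ⟨π i, hker⟩
  have hφ : ∀ x ∈ K, φ (x j) = x i := fun x hx =>
    (π j).liftOfRightInverse_comp_apply _ _ ⟨π i, hker⟩ ⟨x, hx⟩
  have hφs : Function.Surjective φ := by
    intro h
    obtain ⟨x, hx, hxh⟩ := hsurj i h
    exact ⟨x j, by rw [hφ x hx, hxh]⟩
  refine ⟨MulEquiv.ofBijective φ (Finite.surjective_iff_bijective.1 hφs),
    hφ (fun l => (U l).1) (Subgroup.subset_closure ?_),
    hφ (fun l => (U l).2.1) (Subgroup.subset_closure ?_),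
    hφ (fun l => (U l).2.2) (Subgroup.subset_closure ?_)⟩ <;> simp

end Products

section Full

variable {H : Type*} [Group H] [Finite H]

theorem pow_ne_one_iff_pFull {ι : Type*} {A : ι → H} {p m : ℕ} (hp : p.Prime)
    (hpH : p ∣ Nat.card H) (hfull : ∃ j, pFull p (A j)) (hm : A ^ m ≠ 1)
    (hmp : A ^ (m * p) = 1) (j : ι) : A j ^ m ≠ 1 ↔ pFull p (A j) := by
  set e := (Monoid.exponent H).factorization p
  have hexp : Monoid.exponent H ≠ 0 := Monoid.exponent_ne_zero_of_finite
  have hpos : 0 < e := hp.factorization_pos_of_dvd hexp <|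
    have : Fact p.Prime := ⟨hp⟩
    have ⟨x, hx⟩ := exists_prime_orderOf_dvd_card' p hpH
    hx ▸ Monoid.order_dvd_exponent x
  have hdvd : ∀ j, orderOf (A j) ∣ m * p := fun j =>
    orderOf_dvd_of_pow_eq_one (congrFun hmp j)
  have hsplit : ∀ j, ∀ v, (orderOf (A j)).factorization p ≤ v → p ^ v ∣ m → A j ^ m = 1 := by
    intro j v hv hvm
    apply orderOf_dvd_iff_pow_eq_one.1
    have h0 : orderOf (A j) ≠ 0 := (orderOf_pos _).ne'
    rw [← Nat.ordProj_mul_ordCompl_eq_self (orderOf (A j)) p]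
    have hc : Nat.Coprime p (orderOf (A j) / p ^ (orderOf (A j)).factorization p) :=
      Nat.coprime_ordCompl hp h0
    refine Nat.Coprime.mul_dvd_of_dvd_of_dvd (hc.pow_left _) ((pow_dvd_pow p hv).trans hvm) ?_
    exact hc.symm.dvd_of_dvd_mul_right ((Nat.ordCompl_dvd _ _).trans (hdvd j))
  have hle : ∀ j, (orderOf (A j)).factorization p ≤ e := fun j =>
    (Nat.factorization_le_iff_dvd (orderOf_pos _).ne' hexp).2 (Monoid.order_dvd_exponent _) p
  have hnot : ¬ p ^ e ∣ m := fun h => hm (funext fun j => hsplit j e (hle j) h)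
  constructor
  · intro hj
    by_contra hnf
    apply hj
    refine hsplit j (e - 1) ?_ ?_
    · by_contra! hlt
      exact hnf ((pow_dvd_pow p (by omega : e ≤ (orderOf (A j)).factorization p)).trans
        (Nat.ordProj_dvd _ _))
    · obtain ⟨i, hi⟩ := hfull
      have : p ^ (e - 1) * p ∣ m * p := by
        rw [← pow_succ, Nat.sub_add_cancel hpos]
        exact Dvd.dvd.trans hi (hdvd i)
      exact Nat.dvd_of_mul_dvd_mul_right hp.pos this
  · intro hj h
    exact hnot (Dvd.dvd.trans hj (orderOf_dvd_of_pow_eq_one h))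

theorem exponent_dvd_orderOf {ι : Type*} {A : ι → H}
    (hfull : ∀ p : ℕ, p.Prime → p ∣ Nat.card H → ∃ j, pFull p (A j)) :
    Monoid.exponent H ∣ orderOf A := by
  rw [Nat.dvd_iff_prime_pow_dvd_dvd]
  intro p n hp hn
  rcases Nat.eq_zero_or_pos n with rfl | hn0
  · simp
  obtain ⟨j, hj⟩ := hfull p hp
    ((dvd_pow_self p hn0.ne').trans (hn.trans Group.exponent_dvd_nat_card))
  have hle : n ≤ (Monoid.exponent H).factorization p :=
    (hp.pow_dvd_iff_le_factorization Monoid.exponent_ne_zero_of_finite).1 hn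
  exact ((pow_dvd_pow p hle).trans hj).trans (orderOf_map_dvd (Pi.evalMonoidHom (fun _ => H) j) A)

theorem four_le_exponent (hsimple : IsSimpleGroup H) (hnonab : ∃ a b : H, a * b ≠ b * a) :
    4 ≤ Monoid.exponent H := by
  by_contra! hlt
  have hpos : 0 < Monoid.exponent H := Nat.pos_of_ne_zero Monoid.exponent_ne_zero_of_finite
  obtain ⟨p, hp, n, hn⟩ : ∃ p : ℕ, p.Prime ∧ ∃ n, Monoid.exponent H = p ^ n := by
    interval_cases h : Monoid.exponent H
    · exact ⟨2, Nat.prime_two, 0, rfl⟩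
    · exact ⟨2, Nat.prime_two, 1, rfl⟩
    · exact ⟨3, Nat.prime_three, 1, rfl⟩
  have : Fact p.Prime := ⟨hp⟩
  have hpg : IsPGroup p H := fun g => ⟨n, by rw [← hn, Monoid.pow_exponent_eq_one]⟩
  have hne : Nontrivial H := hsimple.toNontrivial
  have hc : Nontrivial (Subgroup.center H) := hpg.center_nontrivial
  rcases (inferInstance : (Subgroup.center H).Normal).eq_bot_or_eq_top with h | h
  · exact (Subgroup.nontrivial_iff_ne_bot _).1 hc h
  · obtain ⟨a, b, hab⟩ := hnonab
    exact hab ((Subgroup.mem_center_iff.1 (h ▸ Subgroup.mem_top b)) a)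

end Full

theorem sum_inv_lt_one_of_four_le {a b c : ℕ} (ha : 4 ≤ a) (hb : 4 ≤ b) (hc : 4 ≤ c) :
    (1 : ℚ) / a + 1 / b + 1 / c < 1 := by
  have key : ∀ n : ℕ, 4 ≤ n → (1 : ℚ) / n ≤ 1 / 4 := fun n hn =>
    one_div_le_one_div_of_le (by norm_num) (by exact_mod_cast hn)
  linarith [key a ha, key b hb, key c hc]

/-- An element conjugate to powers of both `A` and `B` is trivial if, for every prime `p` dividing
the order of the base group, `A` and `B` have `p`-full coordinates, but not at the same places. -/
theorem eq_one_of_isConj_zpow {H ι : Type*} [Group H] [Finite H] [Finite ι] {A B g : ι → H}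
    (hA : ∀ p : ℕ, p.Prime → p ∣ Nat.card H → ∃ j, pFull p (A j))
    (hB : ∀ p : ℕ, p.Prime → p ∣ Nat.card H → ∃ j, pFull p (B j))
    (hAB : ∀ p : ℕ, p.Prime → p ∣ Nat.card H → ¬ ∀ j, pFull p (A j) ↔ pFull p (B j))
    {m n : ℤ} (hm : IsConj (A ^ m) g) (hn : IsConj (B ^ n) g) : g = 1 := by
  by_contra hg
  obtain ⟨p, hp, hpg⟩ := Nat.exists_prime_and_dvd (mt orderOf_eq_one_iff.1 hg)
  have := Fintype.ofFinite ι
  have hpH : p ∣ Nat.card H := by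
    have h : p ∣ Nat.card (ι → H) := hpg.trans (orderOf_dvd_natCard g)
    rw [Nat.card_fun] at h
    exact hp.dvd_of_dvd_pow h
  obtain ⟨r, hr⟩ := hpg
  have hr0 : 0 < r := Nat.pos_of_ne_zero fun h => (orderOf_pos g).ne' (by simp [hr, h])
  have hgr : g ^ r ≠ 1 := fun h => by
    have := Nat.le_of_dvd hr0 (orderOf_dvd_of_pow_eq_one h)
    nlinarith [hp.two_le]
  have hgrp : g ^ (r * p) = 1 := by rw [mul_comm, ← hr, pow_orderOf_eq_one]
  have key : ∀ {C : ι → H} {l : ℤ},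
      (∀ p : ℕ, p.Prime → p ∣ Nat.card H → ∃ j, pFull p (C j)) → IsConj (C ^ l) g →
      ∀ j, pFull p (C j) ↔ (g ^ r) j ≠ 1 := by
    intro C l hC hl j
    obtain ⟨l', hl'⟩ := mem_powers_iff_mem_zpowers.2 (⟨l, rfl⟩ : C ^ l ∈ Subgroup.zpowers C)
    simp only at hl'
    rw [← hl', isConj_iff] at hl
    obtain ⟨c, hc⟩ := hl
    have hpow : ∀ s, g ^ s = c * C ^ (l' * s) * c⁻¹ := fun s => by
      rw [← hc, conj_pow, pow_mul]
    have hone : ∀ s, g ^ s = 1 ↔ C ^ (l' * s) = 1 := fun s => by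
      rw [hpow, conj_eq_one_iff]
    rw [← pow_ne_one_iff_pFull (m := l' * r) hp hpH (hC p hp hpH) (mt (hone r).2 hgr)
      (by rw [mul_assoc]; exact (hone _).1 hgrp) j, hpow]
    simp only [Pi.mul_apply, Pi.inv_apply, Pi.pow_apply, ne_eq, conj_eq_one_iff]
  exact hAB p hp hpH fun j => (key hA hm j).trans (key hB hn j).symm

theorem beauville_of_p_distinguishing
    {H : Type*} [Group H] [Finite H]
    (hsimple : IsSimpleGroup H) (hnonab : ∃ a b : H, a * b ≠ b * a)
    (t : ℕ) (ht : 1 ≤ t) (T : Fin 2 → Fin t → H × H × H)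
    (hgen : ∀ i s, IsGenTriple (T i s))
    (hdist : ∀ p : ℕ, p.Prime → p ∣ Nat.card H →
      ∃ s, PDistinguishing p (T 0 s) (T 1 s))
    (hineq : ∀ i i' : Fin 2, ∀ s s' : Fin t, ∀ m m' : Fin 3,
      (i, s, m) ≠ (i', s', m') →
      ¬ EquivTriple (cycPerm^[(m : ℕ)] (T i s)) (cycPerm^[(m' : ℕ)] (T i' s')))
    (k : ℕ) (hk1 : 6 * t ≤ k) (hk2 : k ≤ d2 H) :
    IsBeauvilleGroup (Fin k → H) := by
  classical
  let S : Fin 2 × Fin t × Fin 3 → H × H × H := fun x => cycPerm^[(x.2.2 : ℕ)] (T x.1 x.2.1)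
  obtain ⟨e⟩ : Nonempty (Fin 2 × Fin t × Fin 3 ↪ Fin k) :=
    Function.Embedding.nonempty_of_card_le (by simp; omega)
  obtain ⟨U, hU, hUineq, hUe⟩ := exists_extension_of_card_le_d2 S
    (fun x => IsGenTriple.iterate_rotate (hgen _ _) _)
    (fun x y hxy => hineq _ _ _ _ _ _ hxy) e (by simpa using hk2)
  let σ : Equiv.Perm (Fin k) :=
    Equiv.Perm.viaEmbedding
      ((Equiv.swap (0 : Fin 2) 1).prodCongr (Equiv.refl (Fin t × Fin 3))) e
  have hσ : ∀ i s m, σ (e (i, s, m)) = e (Equiv.swap 0 1 i, s, m) := fun i s m =>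
    Equiv.Perm.viaEmbedding_apply _ e (i, s, m)
  let A : Fin 3 → Fin k → H := fun c j => (cycPerm^[(c : ℕ)] (U j)).1
  have hcount : ∀ p i s c,
      (∑ m : Fin 3, if pFull p (A c (e (i, s, m))) then 1 else 0) = nuP p (T i s) := by
    intro p i s c
    rw [← sum_pFull_iterate_cycPerm p (T i s) c]
    simp only [A, hUe, S]
  have hA : ∀ c, ∀ p : ℕ, p.Prime → p ∣ Nat.card H → ∃ j, pFull p (A c j) := by
    intro c p hp hpH
    obtain ⟨s, hs⟩ := hdist p hp hpH
    by_contra! hno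
    apply hs
    rw [← hcount p 0 s c, ← hcount p 1 s c]
    simp [hno]
  have hAσ : ∀ c, ∀ p : ℕ, p.Prime → p ∣ Nat.card H → ∃ j, pFull p ((A c ∘ σ) j) := by
    intro c p hp hpH
    obtain ⟨j, hj⟩ := hA c p hp hpH
    exact ⟨σ.symm j, by simpa using hj⟩
  have hdiff : ∀ c c', ∀ p : ℕ, p.Prime → p ∣ Nat.card H →
      ¬ ∀ j, pFull p (A c j) ↔ pFull p ((A c' ∘ σ) j) := by
    intro c c' p hp hpH h
    obtain ⟨s, hs⟩ := hdist p hp hpH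
    apply hs
    rw [← hcount p 0 s c, ← hcount p 1 s c']
    simp only [h, Function.comp_apply, hσ, Equiv.swap_apply_left]
  have hexp := four_le_exponent hsimple hnonab
  have hord : ∀ B : Fin k → H,
      (∀ p : ℕ, p.Prime → p ∣ Nat.card H → ∃ j, pFull p (B j)) → 4 ≤ orderOf B := fun B hB =>
    hexp.trans (Nat.le_of_dvd (orderOf_pos B) (exponent_dvd_orderOf hB))
  refine ⟨A 0, A 1, A 2, A 0 ∘ σ, A 1 ∘ σ, A 2 ∘ σ, ⟨?_, ?_, ?_⟩, ⟨?_, ?_, ?_⟩, ?_⟩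
  · exact closure_eq_top_of_inequivalent hsimple hnonab hU hUineq
  · exact funext fun j => (hU j).1
  · exact sum_inv_lt_one_of_four_le (hord _ (hA _)) (hord _ (hA _)) (hord _ (hA _))
  · exact closure_eq_top_of_inequivalent hsimple hnonab (U := U ∘ σ)
      (fun j => hU _) (fun i j hij => hUineq _ _ (σ.injective.ne hij))
  · exact funext fun j => (hU (σ j)).1
  · exact sum_inv_lt_one_of_four_le (hord _ (hAσ _)) (hord _ (hAσ _))
      (hord _ (hAσ _))
  · refine Set.eq_singleton_iff_unique_mem.2 ⟨⟨⟨A 0, by simp, 0, by simp⟩,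
      ⟨A 0 ∘ σ, by simp, 0, by simp⟩⟩, ?_⟩
    rintro g ⟨⟨d, hd, m, hm⟩, ⟨d', hd', n, hn⟩⟩
    obtain ⟨c, rfl⟩ : ∃ c, d = A c := by
      rcases hd with h | h | h
      exacts [⟨0, h⟩, ⟨1, h⟩, ⟨2, h⟩]
    obtain ⟨c', rfl⟩ : ∃ c, d' = A c ∘ σ := by
      rcases hd' with h | h | h
      exacts [⟨0, h⟩, ⟨1, h⟩, ⟨2, h⟩]
    exact eq_one_of_isConj_zpow (hA c) (hAσ c') (hdiff c c') hm hn
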